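/- Let F : Ω → ℝ^{n+1} be a smooth immersed hypersurface with unit normal ν, scalar mean curvature H and squared second fundamental form norm |A|². Then for every fixed vector e ∈ ℝ^{n+1}, the function f = ⟨ν, e⟩ satisfies Δ_g f = ⟨∇_g H, e⟩ − |A|² f on Ω, where ∇_g H = Σ_{i,j} g^{ij} ∂_j H ∂_i F ∈ ℝ^{n+1} is the Riemannian gradient of H viewed as an ambient tangent vector. -/

import Mathlib

open Real MeasureTheory

noncomputable section

/-- Partial derivative of a scalar function in the `i`-th coordinate direction. -/
def pd {n : ℕ} (i : Fin n) (φ : (Fin n → ℝ) → ℝ) (x : Fin n → ℝ) : ℝ :=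
  fderiv ℝ φ x (Pi.single i 1)

/-- Induced metric `g_{ij} = ⟨∂_i F, ∂_j F⟩`. -/
def gmat {n m : ℕ} (F : (Fin n → ℝ) → (Fin m → ℝ)) (x : Fin n → ℝ) :
    Matrix (Fin n) (Fin n) ℝ :=
  Matrix.of fun i j => ∑ a, pd i (fun y => F y a) x * pd j (fun y => F y a) x

/-- Inverse metric `g^{ij}`. -/
def ginv {n m : ℕ} (F : (Fin n → ℝ) → (Fin m → ℝ)) (x : Fin n → ℝ) :
    Matrix (Fin n) (Fin n) ℝ :=
  (gmat F x)⁻¹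

/-- Laplace–Beltrami operator `Δ_g φ = g^{-1/2} Σ_{i,j} ∂_i (g^{1/2} g^{ij} ∂_j φ)`. -/
def lapB {n m : ℕ} (F : (Fin n → ℝ) → (Fin m → ℝ)) (φ : (Fin n → ℝ) → ℝ)
    (x : Fin n → ℝ) : ℝ :=
  (Real.sqrt (gmat F x).det)⁻¹ *
    ∑ i, ∑ j, pd i (fun y => Real.sqrt (gmat F y).det * ginv F y i j * pd j φ y) x

/-- Mean curvature vector `H̄ = Δ_g F` (componentwise). -/
def Hvec {n m : ℕ} (F : (Fin n → ℝ) → (Fin m → ℝ)) (x : Fin n → ℝ) : Fin m → ℝ :=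
  fun a => lapB F (fun y => F y a) x

/-- Tangential projection of an ambient vector `V` onto `span{∂_1 F(x), …, ∂_n F(x)}`:
`V^⊤ = Σ_{i,j} g^{ij} ⟨V, ∂_j F⟩ ∂_i F`. -/
def tproj {n m : ℕ} (F : (Fin n → ℝ) → (Fin m → ℝ)) (x : Fin n → ℝ)
    (V : Fin m → ℝ) : Fin m → ℝ :=
  fun a => ∑ i, ∑ j, ginv F x i j * (∑ b, V b * pd j (fun y => F y b) x)
      * pd i (fun y => F y a) x

/-- `S(x) = ⟨F(x), W⟩`. -/
def Sfun {n m : ℕ} (F : (Fin n → ℝ) → (Fin m → ℝ)) (W : Fin m → ℝ)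
    (x : Fin n → ℝ) : ℝ :=
  ∑ a, F x a * W a

/-- Second fundamental form `h_{ij} = ⟨∂_i ν, ∂_j F⟩`. -/
def sff {n m : ℕ} (F ν : (Fin n → ℝ) → (Fin m → ℝ)) (i j : Fin n) (x : Fin n → ℝ) : ℝ :=
  ∑ a, pd i (fun y => ν y a) x * pd j (fun y => F y a) x

/-- Scalar mean curvature `H = Σ_{i,j} g^{ij} h_{ij}`. -/
def meanH {n m : ℕ} (F ν : (Fin n → ℝ) → (Fin m → ℝ)) (x : Fin n → ℝ) : ℝ :=
  ∑ i, ∑ j, ginv F x i j * sff F ν i j x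

/-- `|A|² = Σ g^{ik} g^{jl} h_{ij} h_{kl}`. -/
def normA2 {n m : ℕ} (F ν : (Fin n → ℝ) → (Fin m → ℝ)) (x : Fin n → ℝ) : ℝ :=
  ∑ i, ∑ j, ∑ k, ∑ l, ginv F x i k * ginv F x j l * sff F ν i j x * sff F ν k l x

section Algebra

open Matrix

variable {ι κ : Type*} [Fintype ι] [Fintype κ]

/-- The orthogonal projections onto the row space of `u` and onto the line of its unit normal `v`
add up to the identity. -/
theorem tangent_proj_add_normal_proj [DecidableEq ι] [DecidableEq κ]
    (hcard : Fintype.card κ = Fintype.card ι + 1)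
    {u : Matrix ι κ ℝ} {G : Matrix ι ι ℝ} {v : κ → ℝ} (hG : u * uᵀ * G = 1)
    (huv : u *ᵥ v = 0) (hv : v ⬝ᵥ v = 1) :
    uᵀ * G * u + vecMulVec v v = 1 := by
  have h : fromRows u (replicateRow Unit v) * fromCols (uᵀ * G) (replicateCol Unit v) = 1 := by
    rw [fromRows_mul_fromCols, ← Matrix.mul_assoc, hG, ← replicateCol_mulVec, huv,
      ← Matrix.mul_assoc, ← replicateRow_vecMul, vecMul_transpose, huv, ← fromBlocks_one]
    congr 1
    · simp
    · ext
      simpa [Matrix.mul_apply, dotProduct] using hv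
  have h' := (Matrix.mul_eq_one_comm_of_card_eq _ _ _ (by simp [hcard])).mp h
  rw [fromCols_mul_fromRows] at h'
  rw [← h']
  congr 1
  ext i j
  simp [Matrix.mul_apply, vecMulVec_apply]

/-- The contraction `g^{ik} Γ_{ik}^j` of the Christoffel symbols, expressed through the logarithmic
derivative of the volume density and the divergence of the inverse metric. -/
theorem contracted_christoffel {G : Matrix ι ι ℝ} (hGs : G.IsSymm) {P dG : ι → Matrix ι ι ℝ}
    (hP : ∀ i j k, P i j k = P j i k) (hdG : ∀ i, dG i = -(G * (P i + (P i)ᵀ) * G)) (j : ι) :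
    ∑ i, ((G * P i).trace * G i j + dG i i j) = -∑ i, ∑ k, G i k * (P i * G) k j := by
  have h1 : ∑ i, (G * P i).trace * G i j = ∑ i, (G * (P i)ᵀ * G) i j := by
    simp only [Matrix.trace, Matrix.diag, Matrix.mul_apply, Finset.sum_mul, transpose_apply]
    conv_rhs => rw [Finset.sum_comm]
    refine Finset.sum_congr rfl fun l _ => ?_
    rw [Finset.sum_comm]
    refine Finset.sum_congr rfl fun i _ => Finset.sum_congr rfl fun k _ => ?_
    rw [hGs.apply, hP l i k]
  have h2 : ∀ i, dG i i j = -(G * P i * G) i j - (G * (P i)ᵀ * G) i j := by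
    intro i
    rw [hdG, Matrix.mul_add, Matrix.add_mul, neg_apply, Matrix.add_apply]
    ring
  simp only [h2, Finset.sum_add_distrib, h1, Finset.sum_sub_distrib, Finset.sum_neg_distrib,
    Matrix.mul_assoc]
  simp only [Matrix.mul_apply (M := G) (N := P _ * G)]
  ring

/-- The tangential and normal parts of the rough Laplacian of the unit normal, in terms of the jets
of the immersion and of the normal at one point. -/
theorem laplacian_normal_of_jets [DecidableEq ι] [DecidableEq κ]
    (hcard : Fintype.card κ = Fintype.card ι + 1)
    {u N : Matrix ι κ ℝ} {G : Matrix ι ι ℝ} {v : κ → ℝ} {Q R : ι → Matrix ι κ ℝ}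
    {dG : ι → Matrix ι ι ℝ}
    (hG : u * uᵀ * G = 1) (hGs : G.IsSymm)
    (huv : u *ᵥ v = 0) (hNv : N *ᵥ v = 0) (hv : v ⬝ᵥ v = 1)
    (hs : (N * uᵀ).IsSymm)
    (hQ : ∀ i j, Q i j = Q j i) (hR : ∀ i j, R i j ⬝ᵥ v = -(N i ⬝ᵥ N j))
    (hC : ∀ i j m, R i j ⬝ᵥ u m = R m i ⬝ᵥ u j + N m ⬝ᵥ Q i j - N j ⬝ᵥ Q m i)
    (hdG : ∀ i, dG i = -(G * (Q i * uᵀ + (Q i * uᵀ)ᵀ) * G)) (e : κ → ℝ) :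
    ∑ i, ∑ j, (((G * (Q i * uᵀ)).trace * G i j + dG i i j) * (N j ⬝ᵥ e) + G i j * (R i j ⬝ᵥ e))
      = (∑ i, ∑ j, G i j *
          (∑ k, ∑ l, (dG j k l * (N * uᵀ) k l + G k l * (R j k ⬝ᵥ u l + N k ⬝ᵥ Q j l)))
            * (u i ⬝ᵥ e))
        - (∑ i, ∑ j, ∑ k, ∑ l, G i k * G j l * (N * uᵀ) i j * (N * uᵀ) k l) * (v ⬝ᵥ e) := by
  have hone := tangent_proj_add_normal_proj hcard hG huv hv
  have hW : N = N * uᵀ * G * u := by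
    calc N = N * (uᵀ * G * u + vecMulVec v v) := by rw [hone, Matrix.mul_one]
      _ = _ := by
        rw [Matrix.mul_add, mul_vecMulVec, hNv, zero_vecMulVec, add_zero]
        simp only [Matrix.mul_assoc]
  set h := N * uᵀ with hh
  have hQN : ∀ i, Q i * Nᵀ = Q i * uᵀ * G * h := by
    intro i
    conv_lhs => rw [hW]
    simp only [transpose_mul, hGs.eq, hs.eq, Matrix.mul_assoc]
  have hNN : N * Nᵀ = h * G * h := by
    have h1 : u * Nᵀ = h := by rw [← hs.eq, hh, transpose_mul, transpose_transpose]
    rw [← h1, ← Matrix.mul_assoc, h1, ← hW]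
  set b : ι → ℝ := fun j => ∑ i, ((G * (Q i * uᵀ)).trace * G i j + dG i i j) with hb
  set Z : κ → ℝ := b ᵥ* N + ∑ i, ∑ j, G i j • R i j with hZ
  have hbh : ∀ m, ∑ j, b j * h j m = -∑ i, ∑ k, G i k * (Q i k ⬝ᵥ N m) := by
    intro m
    have h1 : ∀ i k, Q i k ⬝ᵥ N m = ∑ j, (Q i * uᵀ * G) k j * h j m := by
      intro i k
      rw [← Matrix.mul_apply, ← hQN]
      rfl
    have h2 : ∀ j, b j = -∑ i, ∑ k, G i k * (Q i * uᵀ * G) k j := by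
      intro j
      refine contracted_christoffel hGs (fun i j k => ?_) hdG j
      simp only [Matrix.mul_apply, hQ i j]
    simp only [h1, h2, Finset.mul_sum, neg_mul, Finset.sum_neg_distrib, Finset.sum_mul]
    rw [Finset.sum_comm]
    congr 1
    refine Finset.sum_congr rfl fun i _ => ?_
    rw [Finset.sum_comm]
    simp only [mul_assoc]
  have hdGh : ∀ m, ∑ k, ∑ l, dG m k l * h k l = -2 * ∑ i, ∑ j, G i j * (N j ⬝ᵥ Q m i) := by
    intro m
    have h1 : ∑ k, ∑ l, dG m k l * h k l = (dG m * h).trace := by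
      simp only [Matrix.trace, diag, Matrix.mul_apply]
      exact Finset.sum_congr rfl fun k _ => Finset.sum_congr rfl fun l _ => by rw [hs.apply]
    have h2 : ∑ i, ∑ j, G i j * (N j ⬝ᵥ Q m i) = (G * (Q m * Nᵀ)).trace := by
      simp only [Matrix.trace, diag, Matrix.mul_apply (M := G)]
      rw [Finset.sum_comm]
      refine Finset.sum_congr rfl fun k _ => Finset.sum_congr rfl fun l _ => ?_
      rw [hGs.apply, dotProduct_comm]
      rfl
    have h3 : (G * (Q m * uᵀ)ᵀ * G * h).trace = (G * (Q m * uᵀ) * G * h).trace := by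
      rw [← trace_transpose]
      simp only [transpose_mul, transpose_transpose, hGs.eq, hs.eq]
      rw [trace_mul_comm]
      simp only [Matrix.mul_assoc]
    rw [h1, h2, hQN, hdG, Matrix.neg_mul, trace_neg, Matrix.mul_add, Matrix.add_mul, Matrix.add_mul,
      trace_add, h3]
    simp only [Matrix.mul_assoc]
    ring
  have hZu : ∀ m, Z ⬝ᵥ u m
      = ∑ k, ∑ l, (dG m k l * h k l + G k l * (R m k ⬝ᵥ u l + N k ⬝ᵥ Q m l)) := by
    intro m
    have h1 : (b ᵥ* N) ⬝ᵥ u m = ∑ j, b j * h j m := by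
      rw [← dotProduct_mulVec]
      rfl
    have h2 : ∑ k, ∑ l, G k l * (N k ⬝ᵥ Q m l) = ∑ i, ∑ j, G i j * (N j ⬝ᵥ Q m i) := by
      rw [Finset.sum_comm]
      exact Finset.sum_congr rfl fun k _ => Finset.sum_congr rfl fun l _ => by rw [hGs.apply]
    simp only [hZ, add_dotProduct, h1, hbh, sum_dotProduct, smul_dotProduct, smul_eq_mul, hC _ _ m,
      mul_add, mul_sub, Finset.sum_add_distrib, Finset.sum_sub_distrib, hdGh, h2,
      dotProduct_comm (Q _ _)]
    ring
  have hZv : Z ⬝ᵥ v = -∑ i, ∑ j, ∑ k, ∑ l, G i k * G j l * h i j * h k l := by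
    have h1 : (b ᵥ* N) ⬝ᵥ v = 0 := by rw [← dotProduct_mulVec, hNv, dotProduct_zero]
    have h2 : ∀ i j, N i ⬝ᵥ N j = (h * G * h) i j := by
      intro i j
      rw [← hNN]
      rfl
    simp only [hZ, add_dotProduct, h1, sum_dotProduct, smul_dotProduct, smul_eq_mul, hR, h2,
      zero_add, mul_neg, Finset.sum_neg_distrib, Matrix.mul_apply, Finset.sum_mul, Finset.mul_sum]
    congr 1
    refine Finset.sum_congr rfl fun i _ => ?_
    conv_rhs => rw [Finset.sum_comm]
    refine Finset.sum_congr rfl fun k _ => ?_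
    rw [Finset.sum_comm]
    refine Finset.sum_congr rfl fun j _ => Finset.sum_congr rfl fun l _ => ?_
    rw [hs.apply k l]
    ring
  have hZe : Z ⬝ᵥ e = (∑ i, ∑ j, G i j * (Z ⬝ᵥ u j) * (u i ⬝ᵥ e)) + (Z ⬝ᵥ v) * (v ⬝ᵥ e) := by
    have h1 : Z ⬝ᵥ e = Z ⬝ᵥ ((uᵀ * G * u + vecMulVec v v) *ᵥ e) := by rw [hone, one_mulVec]
    rw [h1, add_mulVec, dotProduct_add, vecMulVec_mulVec]
    congr 1
    · rw [Matrix.mul_assoc, ← mulVec_mulVec, dotProduct_mulVec, vecMul_transpose, ← mulVec_mulVec]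
      have h2 : ∀ p q : ι → ℝ, p ⬝ᵥ (G *ᵥ q) = ∑ i, ∑ j, G i j * p j * q i := by
        intro p q
        simp only [dotProduct, mulVec, Finset.mul_sum]
        rw [Finset.sum_comm]
        refine Finset.sum_congr rfl fun i _ => Finset.sum_congr rfl fun j _ => ?_
        rw [hGs.apply]
        ring
      rw [h2]
      refine Finset.sum_congr rfl fun i _ => Finset.sum_congr rfl fun j _ => ?_
      rw [dotProduct_comm Z]
      rfl
    · simp [mul_comm]
  have hL : ∑ i, ∑ j, (((G * (Q i * uᵀ)).trace * G i j + dG i i j) * (N j ⬝ᵥ e)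
      + G i j * (R i j ⬝ᵥ e)) = Z ⬝ᵥ e := by
    simp only [hZ, add_dotProduct, sum_dotProduct, smul_dotProduct, smul_eq_mul,
      Finset.sum_add_distrib, ← dotProduct_mulVec]
    congr 1
    rw [Finset.sum_comm]
    simp only [hb, dotProduct, mulVec, Finset.sum_mul]
  rw [hL, hZe, hZv]
  simp only [hZu]
  ring

end Algebra

section Calculus

open Matrix Topology

variable {n : ℕ} {Ω : Set (Fin n → ℝ)} {φ ψ : (Fin n → ℝ) → ℝ} {x : Fin n → ℝ}

theorem pd_congr_of_eqOn (hΩ : IsOpen Ω) (hx : x ∈ Ω) (h : Set.EqOn φ ψ Ω) (i : Fin n) :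
    pd i φ x = pd i ψ x := by
  rw [pd, pd, (h.eventuallyEq_of_mem (hΩ.mem_nhds hx)).fderiv_eq]

theorem pd_const (c : ℝ) (i : Fin n) : pd i (fun _ => c) x = 0 := by
  simp [pd]

theorem pd_mul (hφ : DifferentiableAt ℝ φ x) (hψ : DifferentiableAt ℝ ψ x) (i : Fin n) :
    pd i (fun y => φ y * ψ y) x = pd i φ x * ψ x + φ x * pd i ψ x := by
  simp only [pd, fderiv_fun_mul hφ hψ, _root_.add_apply, _root_.smul_apply, smul_eq_mul]
  ring

theorem pd_sum {α : Type*} {s : Finset α} {f : α → (Fin n → ℝ) → ℝ}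
    (hf : ∀ a ∈ s, DifferentiableAt ℝ (f a) x) (i : Fin n) :
    pd i (fun y => ∑ a ∈ s, f a y) x = ∑ a ∈ s, pd i (f a) x := by
  simp only [pd, fderiv_fun_sum hf]
  simp

theorem pd_dotProduct {κ : Type*} [Fintype κ] {f g : κ → (Fin n → ℝ) → ℝ}
    (hf : ∀ a, DifferentiableAt ℝ (f a) x) (hg : ∀ a, DifferentiableAt ℝ (g a) x) (i : Fin n) :
    pd i (fun y => ∑ a, f a y * g a y) x
      = ∑ a, pd i (f a) x * g a x + ∑ a, f a x * pd i (g a) x := by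
  rw [pd_sum fun a _ => (hf a).fun_mul (hg a), ← Finset.sum_add_distrib]
  exact Finset.sum_congr rfl fun a _ => pd_mul (hf a) (hg a) i

theorem pd_sqrt (hφ : DifferentiableAt ℝ φ x) (h0 : φ x ≠ 0) (i : Fin n) :
    pd i (fun y => √(φ y)) x = pd i φ x / (2 * √(φ x)) := by
  rw [pd, fderiv_sqrt hφ h0, pd, _root_.smul_apply, smul_eq_mul]
  ring

theorem ContDiffOn.pd (hΩ : IsOpen Ω) (hφ : ContDiffOn ℝ (⊤ : ℕ∞) φ Ω) (i : Fin n) :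
    ContDiffOn ℝ (⊤ : ℕ∞) (pd i φ) Ω :=
  (hφ.fderiv_of_isOpen hΩ (by norm_cast)).clm_apply contDiffOn_const

theorem ContDiffOn.differentiableAt_of_isOpen (hΩ : IsOpen Ω) (hx : x ∈ Ω)
    (hφ : ContDiffOn ℝ (⊤ : ℕ∞) φ Ω) : DifferentiableAt ℝ φ x :=
  (hφ.contDiffAt (hΩ.mem_nhds hx)).differentiableAt (by simp)

theorem pd_comm (hΩ : IsOpen Ω) (hx : x ∈ Ω) (hφ : ContDiffOn ℝ (⊤ : ℕ∞) φ Ω) (i j : Fin n) :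
    pd i (pd j φ) x = pd j (pd i φ) x := by
  have h := hφ.contDiffAt (hΩ.mem_nhds hx)
  have hd : DifferentiableAt ℝ (fderiv ℝ φ) x :=
    (h.fderiv_right (m := 1) (by norm_cast)).differentiableAt (by simp)
  have key : ∀ i j : Fin n, pd i (pd j φ) x
      = fderiv ℝ (fderiv ℝ φ) x (Pi.single i 1) (Pi.single j 1) := by
    intro i j
    change fderiv ℝ (fun y => fderiv ℝ φ y (Pi.single j 1)) x (Pi.single i 1) = _
    rw [fderiv_clm_apply hd (by fun_prop)]
    simp
  rw [key, key]
  exact h.isSymmSndFDerivAt (by simpa using WithTop.coe_le_coe.2 (le_top : (2 : ℕ∞) ≤ ⊤)) _ _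

variable {ι : Type*} [Fintype ι] [DecidableEq ι] {M : (Fin n → ℝ) → Matrix ι ι ℝ}

theorem ContDiffOn.matrix_det (hM : ∀ k l, ContDiffOn ℝ (⊤ : ℕ∞) (fun y => M y k l) Ω) :
    ContDiffOn ℝ (⊤ : ℕ∞) (fun y => (M y).det) Ω := by
  simp only [det_apply']
  exact ContDiffOn.sum fun σ _ => contDiffOn_const.mul (contDiffOn_prod fun k _ => hM _ _)

theorem ContDiffOn.matrix_inv (hM : ∀ k l, ContDiffOn ℝ (⊤ : ℕ∞) (fun y => M y k l) Ω)
    (h0 : ∀ y ∈ Ω, (M y).det ≠ 0) (k l : ι) :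
    ContDiffOn ℝ (⊤ : ℕ∞) (fun y => (M y)⁻¹ k l) Ω := by
  simp only [Matrix.inv_def, Ring.inverse_eq_inv', Matrix.smul_apply, smul_eq_mul, adjugate_apply]
  refine ((ContDiffOn.matrix_det hM).inv h0).mul (ContDiffOn.matrix_det fun k' l' => ?_)
  by_cases hk : k' = l
  · simp only [hk, updateRow_self]
    exact contDiffOn_const
  · simpa only [updateRow_ne hk] using hM k' l'

/-- Jacobi's formula for the derivative of a determinant. -/
theorem pd_det (hM : ∀ k l, DifferentiableAt ℝ (fun y => M y k l) x) (i : Fin n) :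
    pd i (fun y => (M y).det) x
      = ((M x).adjugate * Matrix.of fun k l => pd i (fun y => M y k l) x).trace := by
  have hprod : ∀ σ : Equiv.Perm ι, pd i (fun y => ∏ k, M y (σ k) k) x
      = ∑ k, (∏ l ∈ Finset.univ.erase k, M x (σ l) l) * pd i (fun y => M y (σ k) k) x := by
    intro σ
    simp only [pd]
    rw [(HasFDerivAt.finsetProd fun k _ => (hM (σ k) k).hasFDerivAt).fderiv]
    simp
  have hd : ∀ σ : Equiv.Perm ι, DifferentiableAt ℝ (fun y => ∏ k, M y (σ k) k) x :=
    fun σ => (HasFDerivAt.finsetProd fun k _ => (hM (σ k) k).hasFDerivAt).differentiableAt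
  have hcol : ∀ k, ((M x).adjugate * Matrix.of fun k l => pd i (fun y => M y k l) x) k k
      = ((M x).updateCol k fun l => pd i (fun y => M y l k) x).det := by
    intro k
    rw [← cramer_apply, cramer_eq_adjugate_mulVec]
    rfl
  simp only [Matrix.trace, diag, hcol, det_apply']
  rw [pd_sum fun σ _ => (differentiableAt_const _).fun_mul (hd σ), Finset.sum_comm]
  refine Finset.sum_congr rfl fun σ _ => ?_
  rw [pd_mul (differentiableAt_const _) (hd σ), pd_const, zero_mul, zero_add, hprod,
    Finset.mul_sum]
  refine Finset.sum_congr rfl fun k _ => ?_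
  rw [← Finset.prod_erase_mul _ _ (Finset.mem_univ k)]
  congr 2
  · refine Finset.prod_congr rfl fun l hl => ?_
    rw [updateCol_ne (Finset.ne_of_mem_erase hl)]
  · rw [updateCol_self]

theorem pd_inv (hΩ : IsOpen Ω) (hx : x ∈ Ω)
    (hM : ∀ k l, ContDiffOn ℝ (⊤ : ℕ∞) (fun y => M y k l) Ω)
    (h0 : ∀ y ∈ Ω, (M y).det ≠ 0) (i : Fin n) :
    (Matrix.of fun k l => pd i (fun y => (M y)⁻¹ k l) x)
      = -((M x)⁻¹ * (Matrix.of fun k l => pd i (fun y => M y k l) x) * (M x)⁻¹) := by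
  have hI := ContDiffOn.matrix_inv hM h0
  have hu : ∀ y ∈ Ω, IsUnit (M y).det := fun y hy => (h0 y hy).isUnit
  have key : (Matrix.of fun k l => pd i (fun y => M y k l) x) * (M x)⁻¹
      + M x * (Matrix.of fun k l => pd i (fun y => (M y)⁻¹ k l) x) = 0 := by
    ext k l
    have h1 : pd i (fun y => ∑ j, M y k j * (M y)⁻¹ j l) x = 0 := by
      rw [pd_congr_of_eqOn hΩ hx (ψ := fun _ => (1 : Matrix ι ι ℝ) k l), pd_const]
      intro y hy
      simp only [← Matrix.mul_apply, mul_nonsing_inv _ (hu y hy)]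
    rw [pd_dotProduct (fun j => (hM k j).differentiableAt_of_isOpen hΩ hx)
      (fun j => (hI j l).differentiableAt_of_isOpen hΩ hx)] at h1
    simpa [Matrix.mul_apply] using h1
  rw [Matrix.mul_assoc, eq_neg_of_add_eq_zero_left key, Matrix.mul_neg, neg_neg,
    nonsing_inv_mul_cancel_left _ _ (hu x hx)]

end Calculus

section Immersion

open Matrix

variable {n m : ℕ} {Ω : Set (Fin n → ℝ)} {F ν : (Fin n → ℝ) → (Fin m → ℝ)} {x : Fin n → ℝ}

/-- The matrix with rows `∂_i F`. -/
def jac (F : (Fin n → ℝ) → (Fin m → ℝ)) (x : Fin n → ℝ) : Matrix (Fin n) (Fin m) ℝ :=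
  Matrix.of fun i a => pd i (fun y => F y a) x

/-- The matrix with rows `∂_i ∂_j F`, for fixed `i`. -/
def pdJac (F : (Fin n → ℝ) → (Fin m → ℝ)) (i : Fin n) (x : Fin n → ℝ) :
    Matrix (Fin n) (Fin m) ℝ :=
  Matrix.of fun j a => pd i (pd j fun y => F y a) x

theorem gmat_eq (F : (Fin n → ℝ) → (Fin m → ℝ)) (x : Fin n → ℝ) :
    gmat F x = jac F x * (jac F x)ᵀ :=
  rfl

theorem sff_eq (F ν : (Fin n → ℝ) → (Fin m → ℝ)) (i j : Fin n) (x : Fin n → ℝ) :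
    sff F ν i j x = (jac ν x * (jac F x)ᵀ) i j :=
  rfl

theorem ginv_isSymm (F : (Fin n → ℝ) → (Fin m → ℝ)) (x : Fin n → ℝ) : (ginv F x).IsSymm := by
  rw [IsSymm, ginv, transpose_nonsing_inv, gmat_eq, transpose_mul, transpose_transpose]

theorem pdJac_comm (hΩ : IsOpen Ω) (hF : ContDiffOn ℝ (⊤ : ℕ∞) F Ω) (hx : x ∈ Ω) (i j : Fin n) :
    pdJac F i x j = pdJac F j x i :=
  funext fun a => pd_comm hΩ hx (contDiffOn_pi.1 hF a) i j

theorem contDiffOn_pd_component (hΩ : IsOpen Ω) (hF : ContDiffOn ℝ (⊤ : ℕ∞) F Ω) (i : Fin n)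
    (a : Fin m) : ContDiffOn ℝ (⊤ : ℕ∞) (pd i fun y => F y a) Ω :=
  (contDiffOn_pi.1 hF a).pd hΩ i

theorem contDiffOn_sff (hΩ : IsOpen Ω) (hF : ContDiffOn ℝ (⊤ : ℕ∞) F Ω)
    (hν : ContDiffOn ℝ (⊤ : ℕ∞) ν Ω) (k l : Fin n) :
    ContDiffOn ℝ (⊤ : ℕ∞) (sff F ν k l) Ω :=
  ContDiffOn.sum fun a _ =>
    (contDiffOn_pd_component hΩ hν k a).mul (contDiffOn_pd_component hΩ hF l a)

theorem contDiffOn_gmat (hΩ : IsOpen Ω) (hF : ContDiffOn ℝ (⊤ : ℕ∞) F Ω) (k l : Fin n) :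
    ContDiffOn ℝ (⊤ : ℕ∞) (fun y => gmat F y k l) Ω :=
  contDiffOn_sff hΩ hF hF k l

theorem contDiffOn_ginv (hΩ : IsOpen Ω) (hF : ContDiffOn ℝ (⊤ : ℕ∞) F Ω)
    (himm : ∀ y ∈ Ω, (gmat F y).PosDef) (k l : Fin n) :
    ContDiffOn ℝ (⊤ : ℕ∞) (fun y => ginv F y k l) Ω :=
  ContDiffOn.matrix_inv (contDiffOn_gmat hΩ hF) (fun y hy => (himm y hy).det_pos.ne') k l

theorem pd_sff (hΩ : IsOpen Ω) (hF : ContDiffOn ℝ (⊤ : ℕ∞) F Ω)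
    (hν : ContDiffOn ℝ (⊤ : ℕ∞) ν Ω) (hx : x ∈ Ω) (i k l : Fin n) :
    pd i (sff F ν k l) x = pdJac ν i x k ⬝ᵥ jac F x l + jac ν x k ⬝ᵥ pdJac F i x l :=
  pd_dotProduct
    (fun a => (contDiffOn_pd_component hΩ hν k a).differentiableAt_of_isOpen hΩ hx)
    (fun a => (contDiffOn_pd_component hΩ hF l a).differentiableAt_of_isOpen hΩ hx) i

theorem pd_gmat (hΩ : IsOpen Ω) (hF : ContDiffOn ℝ (⊤ : ℕ∞) F Ω) (hx : x ∈ Ω) (i : Fin n) :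
    (Matrix.of fun k l => pd i (fun y => gmat F y k l) x)
      = pdJac F i x * (jac F x)ᵀ + (pdJac F i x * (jac F x)ᵀ)ᵀ := by
  ext k l
  refine (pd_sff hΩ hF hF hx i k l).trans ?_
  rw [dotProduct_comm (jac F x k)]
  rfl

theorem pd_ginv (hΩ : IsOpen Ω) (hF : ContDiffOn ℝ (⊤ : ℕ∞) F Ω)
    (himm : ∀ y ∈ Ω, (gmat F y).PosDef) (hx : x ∈ Ω) (i : Fin n) :
    (Matrix.of fun k l => pd i (fun y => ginv F y k l) x)
      = -(ginv F x * (pdJac F i x * (jac F x)ᵀ + (pdJac F i x * (jac F x)ᵀ)ᵀ) * ginv F x) := by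
  rw [← pd_gmat hΩ hF hx]
  exact pd_inv hΩ hx (contDiffOn_gmat hΩ hF) (fun y hy => (himm y hy).det_pos.ne') i

/-- The logarithmic derivative of the volume density. -/
theorem pd_sqrt_det_gmat (hΩ : IsOpen Ω) (hF : ContDiffOn ℝ (⊤ : ℕ∞) F Ω)
    (himm : ∀ y ∈ Ω, (gmat F y).PosDef) (hx : x ∈ Ω) (i : Fin n) :
    pd i (fun y => √(gmat F y).det) x
      = √(gmat F x).det * (ginv F x * (pdJac F i x * (jac F x)ᵀ)).trace := by
  have hpos := (himm x hx).det_pos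
  have hadj : (gmat F x).adjugate = (gmat F x).det • ginv F x := by
    rw [ginv, Matrix.inv_def, smul_smul, Ring.mul_inverse_cancel _ hpos.ne'.isUnit, one_smul]
  have htr : (ginv F x * (pdJac F i x * (jac F x)ᵀ)ᵀ).trace
      = (ginv F x * (pdJac F i x * (jac F x)ᵀ)).trace := by
    rw [← trace_transpose, transpose_mul, transpose_transpose, (ginv_isSymm F x).eq,
      trace_mul_comm]
  rw [pd_sqrt ((ContDiffOn.matrix_det (contDiffOn_gmat hΩ hF)).differentiableAt_of_isOpen hΩ hx)
      hpos.ne',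
    pd_det fun k l => (contDiffOn_gmat hΩ hF k l).differentiableAt_of_isOpen hΩ hx,
    pd_gmat hΩ hF hx, hadj, smul_mul, trace_smul, Matrix.mul_add, trace_add, htr, smul_eq_mul]
  have hs := Real.sq_sqrt hpos.le
  have hs0 := (Real.sqrt_pos.2 hpos).ne'
  rw [div_eq_iff (by positivity)]
  linear_combination (-2 * (ginv F x * (pdJac F i x * (jac F x)ᵀ)).trace) * hs

theorem pd_meanH (hΩ : IsOpen Ω) (hF : ContDiffOn ℝ (⊤ : ℕ∞) F Ω)
    (himm : ∀ y ∈ Ω, (gmat F y).PosDef) (hν : ContDiffOn ℝ (⊤ : ℕ∞) ν Ω) (hx : x ∈ Ω)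
    (i : Fin n) :
    pd i (meanH F ν) x = ∑ k, ∑ l, (pd i (fun y => ginv F y k l) x * sff F ν k l x
      + ginv F x k l * (pdJac ν i x k ⬝ᵥ jac F x l + jac ν x k ⬝ᵥ pdJac F i x l)) := by
  have hG := fun k l => (contDiffOn_ginv hΩ hF himm k l).differentiableAt_of_isOpen hΩ hx
  have hh := fun k l => (contDiffOn_sff hΩ hF hν k l).differentiableAt_of_isOpen hΩ hx
  change pd i (fun y => ∑ k, ∑ l, ginv F y k l * sff F ν k l y) x = _
  rw [pd_sum fun k _ => DifferentiableAt.fun_sum fun l _ => (hG k l).fun_mul (hh k l)]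
  refine Finset.sum_congr rfl fun k _ => ?_
  rw [pd_sum fun l _ => (hG k l).fun_mul (hh k l)]
  refine Finset.sum_congr rfl fun l _ => ?_
  rw [pd_mul (hG k l) (hh k l), pd_sff hΩ hF hν hx]

theorem lapB_eq (hΩ : IsOpen Ω) (hF : ContDiffOn ℝ (⊤ : ℕ∞) F Ω)
    (himm : ∀ y ∈ Ω, (gmat F y).PosDef) {φ : (Fin n → ℝ) → ℝ} (hφ : ContDiffOn ℝ (⊤ : ℕ∞) φ Ω)
    (hx : x ∈ Ω) :
    lapB F φ x = ∑ i, ∑ j, (((ginv F x * (pdJac F i x * (jac F x)ᵀ)).trace * ginv F x i j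
      + pd i (fun y => ginv F y i j) x) * pd j φ x + ginv F x i j * pd i (pd j φ) x) := by
  have hpos := (himm x hx).det_pos
  have hs0 := (Real.sqrt_pos.2 hpos).ne'
  have hs : DifferentiableAt ℝ (fun y => √(gmat F y).det) x :=
    ((ContDiffOn.matrix_det (contDiffOn_gmat hΩ hF)).differentiableAt_of_isOpen hΩ hx).sqrt
      hpos.ne'
  have hG := fun k l => (contDiffOn_ginv hΩ hF himm k l).differentiableAt_of_isOpen hΩ hx
  have hp := fun j => (hφ.pd hΩ j).differentiableAt_of_isOpen hΩ hx
  rw [lapB, Finset.mul_sum]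
  refine Finset.sum_congr rfl fun i _ => ?_
  rw [Finset.mul_sum]
  refine Finset.sum_congr rfl fun j _ => ?_
  rw [pd_mul (hs.fun_mul (hG i j)) (hp j), pd_mul hs (hG i j), pd_sqrt_det_gmat hΩ hF himm hx]
  field_simp

theorem pd_component_sum (hΩ : IsOpen Ω) (hν : ContDiffOn ℝ (⊤ : ℕ∞) ν Ω) (e : Fin m → ℝ)
    (hx : x ∈ Ω) (j : Fin n) :
    pd j (fun y => ∑ a, ν y a * e a) x = jac ν x j ⬝ᵥ e := by
  rw [pd_dotProduct (g := fun a _ => e a)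
    (fun a => (contDiffOn_pi.1 hν a).differentiableAt_of_isOpen hΩ hx)
    (fun a => differentiableAt_const _)]
  simp only [pd_const, mul_zero, Finset.sum_const_zero, add_zero]
  rfl

theorem pd_pd_component_sum (hΩ : IsOpen Ω) (hν : ContDiffOn ℝ (⊤ : ℕ∞) ν Ω) (e : Fin m → ℝ)
    (hx : x ∈ Ω) (i j : Fin n) :
    pd i (pd j fun y => ∑ a, ν y a * e a) x = pdJac ν i x j ⬝ᵥ e := by
  rw [pd_congr_of_eqOn hΩ hx (ψ := fun y => ∑ a, pd j (fun z => ν z a) y * e a)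
    fun y hy => pd_component_sum hΩ hν e hy j]
  rw [pd_dotProduct (g := fun a _ => e a)
    (fun a => (contDiffOn_pd_component hΩ hν j a).differentiableAt_of_isOpen hΩ hx)
    (fun a => differentiableAt_const _)]
  simp only [pd_const, mul_zero, Finset.sum_const_zero, add_zero]
  rfl

theorem jac_mulVec_of_unit (hΩ : IsOpen Ω) (hν : ContDiffOn ℝ (⊤ : ℕ∞) ν Ω)
    (hνunit : ∀ y ∈ Ω, ∑ a, (ν y a) ^ 2 = 1) (hx : x ∈ Ω) : jac ν x *ᵥ ν x = 0 := by
  have hd := fun a => (contDiffOn_pi.1 hν a).differentiableAt_of_isOpen hΩ hx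
  ext i
  have h := pd_dotProduct hd hd i
  rw [pd_congr_of_eqOn hΩ hx (ψ := fun _ => 1)
    (fun y hy => by simpa only [sq] using hνunit y hy), pd_const] at h
  have h1 : (jac ν x *ᵥ ν x) i = ∑ a, pd i (fun y => ν y a) x * ν x a := rfl
  have h2 : ∑ a, ν x a * pd i (fun y => ν y a) x = ∑ a, pd i (fun y => ν y a) x * ν x a :=
    Finset.sum_congr rfl fun a _ => mul_comm _ _
  rw [h1, Pi.zero_apply]
  linarith

theorem pdJac_dotProduct_of_unit (hΩ : IsOpen Ω) (hν : ContDiffOn ℝ (⊤ : ℕ∞) ν Ω)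
    (hνunit : ∀ y ∈ Ω, ∑ a, (ν y a) ^ 2 = 1) (hx : x ∈ Ω) (i j : Fin n) :
    pdJac ν i x j ⬝ᵥ ν x = -(jac ν x i ⬝ᵥ jac ν x j) := by
  have h := pd_dotProduct
    (fun a => (contDiffOn_pd_component hΩ hν j a).differentiableAt_of_isOpen hΩ hx)
    (fun a => (contDiffOn_pi.1 hν a).differentiableAt_of_isOpen hΩ hx) i
  rw [pd_congr_of_eqOn hΩ hx (φ := fun y => ∑ a, pd j (fun z => ν z a) y * ν y a)
    (ψ := fun _ => 0) (fun y hy => congrFun (jac_mulVec_of_unit hΩ hν hνunit hy) j), pd_const] at h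
  rw [dotProduct_comm (jac ν x i)]
  exact eq_neg_of_add_eq_zero_left h.symm

theorem sff_symm (hΩ : IsOpen Ω) (hF : ContDiffOn ℝ (⊤ : ℕ∞) F Ω)
    (hν : ContDiffOn ℝ (⊤ : ℕ∞) ν Ω)
    (hνperp : ∀ y ∈ Ω, ∀ i, ∑ a, ν y a * pd i (fun z => F z a) y = 0) (hx : x ∈ Ω)
    (i j : Fin n) : sff F ν i j x = sff F ν j i x := by
  have key : ∀ i j, sff F ν i j x = -(ν x ⬝ᵥ pdJac F i x j) := by
    intro i j
    have h := pd_dotProduct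
      (fun a => (contDiffOn_pi.1 hν a).differentiableAt_of_isOpen hΩ hx)
      (fun a => (contDiffOn_pd_component hΩ hF j a).differentiableAt_of_isOpen hΩ hx) i
    rw [pd_congr_of_eqOn hΩ hx (ψ := fun _ => 0) (fun y hy => hνperp y hy j), pd_const] at h
    exact eq_neg_of_add_eq_zero_left h.symm
  rw [key, key, pdJac_comm hΩ hF hx]

/-- The Codazzi equation. -/
theorem codazzi (hΩ : IsOpen Ω) (hF : ContDiffOn ℝ (⊤ : ℕ∞) F Ω)
    (hν : ContDiffOn ℝ (⊤ : ℕ∞) ν Ω)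
    (hνperp : ∀ y ∈ Ω, ∀ i, ∑ a, ν y a * pd i (fun z => F z a) y = 0) (hx : x ∈ Ω)
    (i j k : Fin n) :
    pdJac ν i x j ⬝ᵥ jac F x k = pdJac ν k x i ⬝ᵥ jac F x j + jac ν x k ⬝ᵥ pdJac F i x j
      - jac ν x j ⬝ᵥ pdJac F k x i := by
  have h := pd_congr_of_eqOn hΩ hx (fun y hy => sff_symm hΩ hF hν hνperp hy j k) i
  rw [pd_sff hΩ hF hν hx, pd_sff hΩ hF hν hx, pdJac_comm hΩ hν hx i k,
    pdJac_comm hΩ hF hx i k] at h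
  linarith

theorem sum_gradient_dotProduct (G : Matrix (Fin n) (Fin n) ℝ) (X : Fin n → ℝ) (e : Fin m → ℝ) :
    ∑ i, ∑ j, G i j * X j * (jac F x i ⬝ᵥ e)
      = ∑ a, (∑ i, ∑ j, G i j * X j * pd i (fun y => F y a) x) * e a := by
  simp only [dotProduct, Finset.sum_mul, Finset.mul_sum]
  conv_rhs => rw [Finset.sum_comm]
  refine Finset.sum_congr rfl fun i _ => ?_
  conv_rhs => rw [Finset.sum_comm]
  exact Finset.sum_congr rfl fun j _ => Finset.sum_congr rfl fun a _ => (mul_assoc _ _ _).symm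

end Immersion

/-- For any immersed hypersurface with unit normal `ν` and any fixed
vector `e`, the function `f = ⟨ν, e⟩` satisfies `Δ_g f = ⟨∇_g H, e⟩ − |A|² f` on `Ω`. -/
theorem lap_normal_component {n : ℕ} (hn : 1 ≤ n)
    (Ω : Set (Fin n → ℝ)) (hΩo : IsOpen Ω) (hΩne : Ω.Nonempty)
    (F : (Fin n → ℝ) → (Fin (n + 1) → ℝ)) (hF : ContDiffOn ℝ (⊤ : ℕ∞) F Ω)
    (himm : ∀ x ∈ Ω, (gmat F x).PosDef)
    (ν : (Fin n → ℝ) → (Fin (n + 1) → ℝ)) (hν : ContDiffOn ℝ (⊤ : ℕ∞) ν Ω)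
    (hνunit : ∀ x ∈ Ω, ∑ a, (ν x a) ^ 2 = 1)
    (hνperp : ∀ x ∈ Ω, ∀ i, ∑ a, ν x a * pd i (fun y => F y a) x = 0)
    (e : Fin (n + 1) → ℝ) :
    ∀ x ∈ Ω,
      lapB F (fun y => ∑ a, ν y a * e a) x
        = (∑ a, (∑ i, ∑ j, ginv F x i j * pd j (meanH F ν) x
              * pd i (fun y => F y a) x) * e a)
          - normA2 F ν x * ∑ a, ν x a * e a := by
  intro x hx
  have hG : jac F x * (jac F x).transpose * ginv F x = 1 :=
    Matrix.mul_nonsing_inv _ (himm x hx).det_pos.ne'.isUnit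
  have huv : (jac F x).mulVec (ν x) = 0 := by
    ext i
    exact (Finset.sum_congr rfl fun a _ => mul_comm (jac F x i a) (ν x a)).trans (hνperp x hx i)
  have hv : dotProduct (ν x) (ν x) = 1 := by simpa only [dotProduct, sq] using hνunit x hx
  have hsymm : (jac ν x * (jac F x).transpose).IsSymm :=
    Matrix.IsSymm.ext fun i j => sff_symm hΩo hF hν hνperp hx j i
  have hf : ContDiffOn ℝ (⊤ : ℕ∞) (fun y => ∑ a, ν y a * e a) Ω :=
    ContDiffOn.sum fun a _ => (contDiffOn_pi.1 hν a).mul contDiffOn_const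
  have key := laplacian_normal_of_jets (by simp) hG (ginv_isSymm F x) huv
    (jac_mulVec_of_unit hΩo hν hνunit hx) hv hsymm (pdJac_comm hΩo hF hx)
    (pdJac_dotProduct_of_unit hΩo hν hνunit hx) (codazzi hΩo hF hν hνperp hx)
    (pd_ginv hΩo hF himm hx) e
  rw [lapB_eq hΩo hF himm hf hx]
  simp only [pd_component_sum hΩo hν e hx, pd_pd_component_sum hΩo hν e hx,
    pd_meanH hΩo hF himm hν hx]
  refine key.trans ?_
  rw [sum_gradient_dotProduct]
  rfl
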